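/- arXiv:0810.3731 — 6 statements merged into one kernel-verified Lean document; each statement's English description precedes it below -/
import Mathlib

section
/- Let m ∈ ℕ and let J : ℝ^m → (Fin m → Fin m → ℝ) be a smooth matrix-valued function that is antisymmetric, i.e. J x i j = − J x j i for all x, i, j. For smooth f, g : ℝ^m → ℝ define the bracket [f,g](x) = Σ_{i,j} J x i j · ∂_i f(x) · ∂_j g(x), where ∂_l denotes the partial derivative in the l-th coordinate direction. Then the Jacobi identity [[f,g],h] + [[g,h],f] + [[h,f],g] = 0 holds for all smooth f, g, h : ℝ^m → ℝ if and only if the Jacobiizer of J vanishes identically, i.e. for all x and all indices k, i, j: Σ_l (J x l k · ∂_l J x i j + J x l i · ∂_l J x j k + J x l j · ∂_l J x k i) = 0. -/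
/-- The partial derivative of `f : ℝ^m → ℝ` in the `l`-th coordinate direction. -/
noncomputable def pd {m : ℕ} (l : Fin m) (f : (Fin m → ℝ) → ℝ) (x : Fin m → ℝ) : ℝ :=
  fderiv ℝ f x (Pi.single l 1)

/-- The bracket of functions associated with an antisymmetric matrix field `J`:
`[f,g](x) = Σ_{i,j} J x i j · ∂_i f(x) · ∂_j g(x)`. -/
noncomputable def pbracket {m : ℕ} (J : (Fin m → ℝ) → Fin m → Fin m → ℝ)
    (f g : (Fin m → ℝ) → ℝ) : (Fin m → ℝ) → ℝ :=
  fun x => ∑ i, ∑ j, J x i j * pd i f x * pd j g x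

/-- The Jacobiizer of `J`, with components
`J^{kij}(x) = Σ_l (J x l k · ∂_l J x i j + J x l i · ∂_l J x j k + J x l j · ∂_l J x k i)`. -/
noncomputable def jacobiizer {m : ℕ} (J : (Fin m → ℝ) → Fin m → Fin m → ℝ)
    (x : Fin m → ℝ) (k i j : Fin m) : ℝ :=
  ∑ l, (J x l k * pd l (fun y => J y i j) x + J x l i * pd l (fun y => J y j k) x +
    J x l j * pd l (fun y => J y k i) x)

theorem pd_contDiff {m : ℕ} (l : Fin m) (f : (Fin m → ℝ) → ℝ) (hf : ContDiff ℝ (⊤ : ℕ∞) f) :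
    ContDiff ℝ (⊤ : ℕ∞) (pd l f) := by
  have h : ContDiff ℝ (⊤ : ℕ∞) (fderiv ℝ f) := hf.fderiv_right (by simp)
  exact h.clm_apply contDiff_const

theorem pd_symm {m : ℕ} (l i : Fin m) (f : (Fin m → ℝ) → ℝ) (hf : ContDiff ℝ (⊤ : ℕ∞) f)
    (x : Fin m → ℝ) : pd l (pd i f) x = pd i (pd l f) x := by
  have h : ContDiff ℝ (⊤ : ℕ∞) (fderiv ℝ f) := hf.fderiv_right (by simp)
  have hd : DifferentiableAt ℝ (fderiv ℝ f) x := (h.differentiable (by simp)) x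
  have key : ∀ a b : Fin m, pd a (pd b f) x
      = fderiv ℝ (fderiv ℝ f) x (Pi.single a 1) (Pi.single b 1) := by
    intro a b
    have : pd b f = fun y => fderiv ℝ f y (Pi.single b 1) := rfl
    rw [this]
    unfold pd
    rw [fderiv_clm_apply hd (differentiableAt_const _)]
    simp
  rw [key, key]
  have hs : IsSymmSndFDerivAt ℝ f x :=
    hf.contDiffAt.isSymmSndFDerivAt (by simpa using (by exact_mod_cast le_top : ((2 : ℕ∞) : WithTop ℕ∞) ≤ ((⊤ : ℕ∞) : WithTop ℕ∞)))
  exact hs _ _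

theorem pd_pbracket {m : ℕ} (J : (Fin m → ℝ) → Fin m → Fin m → ℝ)
    (hJ : ∀ i j, ContDiff ℝ (⊤ : ℕ∞) fun x => J x i j) (f g : (Fin m → ℝ) → ℝ)
    (hf : ContDiff ℝ (⊤ : ℕ∞) f) (hg : ContDiff ℝ (⊤ : ℕ∞) g) (l : Fin m) (x : Fin m → ℝ) :
    pd l (pbracket J f g) x = ∑ i, ∑ j, (pd l (fun y => J y i j) x * pd i f x * pd j g x
      + J x i j * pd l (pd i f) x * pd j g x + J x i j * pd i f x * pd l (pd j g) x) := by
  have dJ : ∀ i j, HasFDerivAt (fun y => J y i j) (fderiv ℝ (fun y => J y i j) x) x :=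
    fun i j => ((hJ i j).differentiable (by simp) x).hasFDerivAt
  have df : ∀ i, HasFDerivAt (pd i f) (fderiv ℝ (pd i f) x) x :=
    fun i => ((pd_contDiff i f hf).differentiable (by simp) x).hasFDerivAt
  have dg : ∀ i, HasFDerivAt (pd i g) (fderiv ℝ (pd i g) x) x :=
    fun i => ((pd_contDiff i g hg).differentiable (by simp) x).hasFDerivAt
  have H := HasFDerivAt.fun_sum (u := Finset.univ) (fun i _ =>
    HasFDerivAt.fun_sum (u := Finset.univ) (fun j _ => ((dJ i j).mul (df i)).mul (dg j)))
  have H' : HasFDerivAt (pbracket J f g) _ x := H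
  rw [pd, H'.fderiv]
  simp only [_root_.sum_apply, _root_.add_apply,
    _root_.smul_apply, smul_eq_mul]
  refine Finset.sum_congr rfl fun i _ => Finset.sum_congr rfl fun j _ => ?_
  simp only [pd, Pi.mul_apply]
  ring

theorem term_formula {m : ℕ} (A : Fin m → Fin m → ℝ) (hA : ∀ i j, A i j = - A j i)
    (D : Fin m → Fin m → Fin m → ℝ) (u v w : Fin m → ℝ) (U V : Fin m → Fin m → ℝ) :
    ∑ l, ∑ k, A l k * (∑ i, ∑ j, (D l i j * u i * v j + A i j * U l i * v j
      + A i j * u i * V l j)) * w k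
    = (∑ i, ∑ j, ∑ k, (∑ l, A l k * D l i j) * u i * v j * w k)
      + (∑ l, ∑ i, U l i * (∑ j, A i j * v j) * (∑ k, A l k * w k))
      - (∑ l, ∑ i, V l i * (∑ j, A i j * u j) * (∑ k, A l k * w k)) := by
  have e1 : (∑ i, ∑ j, ∑ k, (∑ l, A l k * D l i j) * u i * v j * w k)
      = ∑ l, ∑ k, A l k * (∑ i, ∑ j, D l i j * u i * v j) * w k := by
    simp only [Finset.sum_mul, Finset.mul_sum]
    calc _ = ∑ i, ∑ j, ∑ l, ∑ k, A l k * D l i j * u i * v j * w k :=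
          Finset.sum_congr rfl fun i _ => Finset.sum_congr rfl fun j _ => Finset.sum_comm
      _ = ∑ i, ∑ l, ∑ j, ∑ k, A l k * D l i j * u i * v j * w k :=
          Finset.sum_congr rfl fun i _ => Finset.sum_comm
      _ = ∑ l, ∑ i, ∑ j, ∑ k, A l k * D l i j * u i * v j * w k := Finset.sum_comm
      _ = ∑ l, ∑ i, ∑ k, ∑ j, A l k * D l i j * u i * v j * w k :=
          Finset.sum_congr rfl fun i _ => Finset.sum_congr rfl fun j _ => Finset.sum_comm
      _ = ∑ l, ∑ k, ∑ i, ∑ j, A l k * D l i j * u i * v j * w k :=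
          Finset.sum_congr rfl fun i _ => Finset.sum_comm
      _ = _ := by
          refine Finset.sum_congr rfl fun _ _ => Finset.sum_congr rfl fun _ _ =>
            Finset.sum_congr rfl fun _ _ => Finset.sum_congr rfl fun _ _ => ?_
          ring
  have e2 : ∀ l, ∑ i, ∑ j, A i j * U l i * v j = ∑ i, U l i * (∑ j, A i j * v j) := by
    intro l
    simp only [Finset.mul_sum]
    refine Finset.sum_congr rfl fun _ _ => Finset.sum_congr rfl fun _ _ => ?_
    ring
  have e3 : ∀ l, ∑ i, ∑ j, A i j * u i * V l j = - ∑ i, V l i * (∑ j, A i j * u j) := by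
    intro l
    rw [Finset.sum_comm]
    simp only [Finset.mul_sum, ← Finset.sum_neg_distrib]
    refine Finset.sum_congr rfl fun a _ => Finset.sum_congr rfl fun b _ => ?_
    rw [hA b a]
    ring
  rw [e1, ← Finset.sum_add_distrib, ← Finset.sum_sub_distrib]
  refine Finset.sum_congr rfl fun l _ => ?_
  rw [← Finset.sum_mul, ← Finset.sum_mul]
  simp only [Finset.sum_add_distrib]
  rw [e2, e3]
  have e4 : ∀ c : ℝ, ∑ k, A l k * c * w k = c * ∑ k, A l k * w k := by
    intro c
    rw [Finset.mul_sum]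
    exact Finset.sum_congr rfl fun _ _ => by ring
  rw [e4, e4]
  ring

theorem jacobi_sum {m : ℕ} (J : (Fin m → ℝ) → Fin m → Fin m → ℝ)
    (hJ : ∀ i j, ContDiff ℝ (⊤ : ℕ∞) fun x => J x i j)
    (hA : ∀ (x : Fin m → ℝ) (i j : Fin m), J x i j = - J x j i)
    (f g h : (Fin m → ℝ) → ℝ) (hf : ContDiff ℝ (⊤ : ℕ∞) f) (hg : ContDiff ℝ (⊤ : ℕ∞) g)
    (hh : ContDiff ℝ (⊤ : ℕ∞) h) (x : Fin m → ℝ) :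
    pbracket J (pbracket J f g) h x + pbracket J (pbracket J g h) f x +
        pbracket J (pbracket J h f) g x
      = ∑ i, ∑ j, ∑ k, jacobiizer J x k i j * pd i f x * pd j g x * pd k h x := by
  have br : ∀ u v w : (Fin m → ℝ) → ℝ, ContDiff ℝ (⊤ : ℕ∞) u → ContDiff ℝ (⊤ : ℕ∞) v →
      pbracket J (pbracket J u v) w x =
      (∑ i, ∑ j, ∑ k, (∑ l, J x l k * pd l (fun y => J y i j) x) * pd i u x * pd j v x * pd k w x)
      + (∑ l, ∑ i, pd l (pd i u) x * (∑ j, J x i j * pd j v x) * (∑ k, J x l k * pd k w x))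
      - (∑ l, ∑ i, pd l (pd i v) x * (∑ j, J x i j * pd j u x) * (∑ k, J x l k * pd k w x)) := by
    intro u v w hu hv
    rw [← term_formula (J x) (hA x) (fun l i j => pd l (fun y => J y i j) x)
      (fun i => pd i u x) (fun i => pd i v x) (fun i => pd i w x)
      (fun l i => pd l (pd i u) x) (fun l i => pd l (pd i v) x)]
    rw [pbracket]
    simp only [pd_pbracket J hJ u v hu hv]
  have sy : ∀ (u : (Fin m → ℝ) → ℝ) (a b : Fin m → ℝ), ContDiff ℝ (⊤ : ℕ∞) u →
      ∑ l, ∑ i, pd l (pd i u) x * a i * b l = ∑ l, ∑ i, pd l (pd i u) x * b i * a l := by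
    intro u a b hu
    rw [Finset.sum_comm]
    refine Finset.sum_congr rfl fun l _ => Finset.sum_congr rfl fun i _ => ?_
    rw [pd_symm i l u hu]
    ring
  rw [br f g h hf hg, br g h f hg hh, br h f g hh hf,
    sy f (fun i => ∑ j, J x i j * pd j g x) (fun i => ∑ j, J x i j * pd j h x) hf,
    sy g (fun i => ∑ j, J x i j * pd j h x) (fun i => ∑ j, J x i j * pd j f x) hg,
    sy h (fun i => ∑ j, J x i j * pd j f x) (fun i => ∑ j, J x i j * pd j g x) hh]
  have r2 : (∑ i, ∑ j, ∑ k, (∑ l, J x l k * pd l (fun y => J y i j) x)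
        * pd i g x * pd j h x * pd k f x)
      = ∑ i, ∑ j, ∑ k, (∑ l, J x l i * pd l (fun y => J y j k) x)
        * pd i f x * pd j g x * pd k h x := by
    calc _ = ∑ j, ∑ i, ∑ k, (∑ l, J x l i * pd l (fun y => J y j k) x)
            * pd j g x * pd k h x * pd i f x :=
          Finset.sum_congr rfl fun _ _ => Finset.sum_comm
      _ = ∑ i, ∑ j, ∑ k, (∑ l, J x l i * pd l (fun y => J y j k) x)
            * pd j g x * pd k h x * pd i f x := Finset.sum_comm
      _ = _ := Finset.sum_congr rfl fun _ _ => Finset.sum_congr rfl fun _ _ =>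
          Finset.sum_congr rfl fun _ _ => by ring
  have r3 : (∑ i, ∑ j, ∑ k, (∑ l, J x l k * pd l (fun y => J y i j) x)
        * pd i h x * pd j f x * pd k g x)
      = ∑ i, ∑ j, ∑ k, (∑ l, J x l j * pd l (fun y => J y k i) x)
        * pd i f x * pd j g x * pd k h x := by
    calc _ = ∑ i, ∑ k, ∑ j, (∑ l, J x l j * pd l (fun y => J y k i) x)
            * pd k h x * pd i f x * pd j g x := Finset.sum_comm
      _ = ∑ i, ∑ j, ∑ k, (∑ l, J x l j * pd l (fun y => J y k i) x)
            * pd k h x * pd i f x * pd j g x :=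
          Finset.sum_congr rfl fun _ _ => Finset.sum_comm
      _ = _ := Finset.sum_congr rfl fun _ _ => Finset.sum_congr rfl fun _ _ =>
          Finset.sum_congr rfl fun _ _ => by ring
  rw [r2, r3]
  simp only [jacobiizer, Finset.sum_add_distrib, add_mul]
  ring

theorem pd_coord {m : ℕ} (l i : Fin m) (x : Fin m → ℝ) :
    pd l (fun y => y i) x = if l = i then 1 else 0 := by
  have : HasFDerivAt (fun y : Fin m → ℝ => y i)
    (ContinuousLinearMap.proj (R := ℝ) (φ := fun _ : Fin m => ℝ) i) x := hasFDerivAt_apply i x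
  rw [pd, this.fderiv]
  simp [Pi.single_apply, eq_comm]

/-- For a smooth antisymmetric matrix field `J` on `ℝ^m`, the associated
bracket satisfies the Jacobi identity for all smooth functions if and only if the
Jacobiizer of `J` vanishes identically. -/
theorem jacobi_identity_iff_jacobiizer_vanishes {m : ℕ}
    (J : (Fin m → ℝ) → Fin m → Fin m → ℝ)
    (hJsmooth : ∀ i j, ContDiff ℝ (⊤ : ℕ∞) fun x => J x i j)
    (hJanti : ∀ (x : Fin m → ℝ) (i j : Fin m), J x i j = - J x j i) :
    (∀ f g h : (Fin m → ℝ) → ℝ, ContDiff ℝ (⊤ : ℕ∞) f → ContDiff ℝ (⊤ : ℕ∞) g → ContDiff ℝ (⊤ : ℕ∞) h →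
      ∀ x, pbracket J (pbracket J f g) h x + pbracket J (pbracket J g h) f x +
        pbracket J (pbracket J h f) g x = 0) ↔
    (∀ (x : Fin m → ℝ) (k i j : Fin m), jacobiizer J x k i j = 0) := by
  constructor
  · intro H x k i j
    have h := H (fun y => y i) (fun y => y j) (fun y => y k) (contDiff_apply ℝ ℝ i)
      (contDiff_apply ℝ ℝ j) (contDiff_apply ℝ ℝ k) x
    rw [jacobi_sum J hJsmooth hJanti _ _ _ (contDiff_apply ℝ ℝ i)
      (contDiff_apply ℝ ℝ j) (contDiff_apply ℝ ℝ k) x] at h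
    simpa [pd_coord] using h
  · intro H f g h hf hg hh x
    rw [jacobi_sum J hJsmooth hJanti f g h hf hg hh x]
    simp [H]
end

section
/- Let m ∈ ℕ and let J, Ω : ℝ^m → (Fin m → Fin m → ℝ) be smooth matrix-valued functions, each antisymmetric, which are pointwise mutually inverse: Σ_j J x i j · Ω x j k = δ_{ik} for all x, i, k. Then for all x and all indices m', n, p: Σ_{k,i,j} (∂_k Ω x i j + ∂_i Ω x j k + ∂_j Ω x k i) · J x k m' · J x i n · J x j p = Σ_l (J x l m' · ∂_l J x n p + J x l n · ∂_l J x p m' + J x l p · ∂_l J x m' n), where ∂_l denotes the partial derivative in the l-th coordinate direction. -/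
/-- The symplecticizer of `Ω`, with components
`Ω_{kij}(x) = ∂_k Ω x i j + ∂_i Ω x j k + ∂_j Ω x k i`. -/
noncomputable def symplecticizer {m : ℕ} (Ω : (Fin m → ℝ) → Fin m → Fin m → ℝ)
    (x : Fin m → ℝ) (k i j : Fin m) : ℝ :=
  pd k (fun y => Ω y i j) x + pd i (fun y => Ω y j k) x + pd j (fun y => Ω y k i) x

theorem pd_contract {m : ℕ}
    (J Ω : (Fin m → ℝ) → Fin m → Fin m → ℝ)
    (hJsmooth : ∀ i j, ContDiff ℝ (⊤ : ℕ∞) fun x => J x i j)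
    (hΩsmooth : ∀ i j, ContDiff ℝ (⊤ : ℕ∞) fun x => Ω x i j)
    (hJanti : ∀ (x : Fin m → ℝ) (i j : Fin m), J x i j = - J x j i)
    (hinv : ∀ (x : Fin m → ℝ) (i k : Fin m),
      ∑ j, J x i j * Ω x j k = if i = k then (1 : ℝ) else 0)
    (x : Fin m → ℝ) (l n p : Fin m) :
    ∑ i, ∑ j, pd l (fun y => Ω y i j) x * J x i n * J x j p = pd l (fun y => J y n p) x := by
  have hJd : ∀ i j, DifferentiableAt ℝ (fun y => J y i j) x := fun i j =>
    ((hJsmooth i j).differentiable (by simp)).differentiableAt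
  have hΩd : ∀ i j, DifferentiableAt ℝ (fun y => Ω y i j) x := fun i j =>
    ((hΩsmooth i j).differentiable (by simp)).differentiableAt
  let A : Matrix (Fin m) (Fin m) ℝ := Matrix.of (J x)
  let B : Matrix (Fin m) (Fin m) ℝ := Matrix.of (Ω x)
  let A' : Matrix (Fin m) (Fin m) ℝ := Matrix.of fun i j => pd l (fun y => J y i j) x
  let B' : Matrix (Fin m) (Fin m) ℝ := Matrix.of fun i j => pd l (fun y => Ω y i j) x
  have hAB : A * B = 1 := by
    ext i k
    simp only [Matrix.mul_apply, Matrix.one_apply]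
    exact hinv x i k
  have hBA : B * A = 1 := mul_eq_one_comm.mp hAB
  have hd : A' * B + A * B' = 0 := by
    ext i k
    have h1 : HasFDerivAt (fun y => ∑ j, J y i j * Ω y j k)
        (∑ j, (J x i j • fderiv ℝ (fun y => Ω y j k) x
          + Ω x j k • fderiv ℝ (fun y => J y i j) x)) x :=
      HasFDerivAt.fun_sum fun j _ => (hJd i j).hasFDerivAt.mul (hΩd j k).hasFDerivAt
    have h2 : (fun y => ∑ j, J y i j * Ω y j k) = fun _ => if i = k then (1 : ℝ) else 0 :=
      funext fun y => hinv y i k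
    rw [h2] at h1
    have h3 := h1.unique (hasFDerivAt_const _ x)
    have h4 := congrArg (fun L => L (Pi.single l 1)) h3
    simp only [ContinuousLinearMap.sum_apply, ContinuousLinearMap.add_apply,
      ContinuousLinearMap.smul_apply, smul_eq_mul, ContinuousLinearMap.zero_apply] at h4
    simp only [Matrix.add_apply, Matrix.mul_apply, Matrix.zero_apply, ← Finset.sum_add_distrib]
    rw [← h4]
    refine Finset.sum_congr rfl fun j _ => ?_
    simp only [A, B, A', B', Matrix.of_apply, pd]
    ring
  have h5 : A' = -(A * B' * A) := by
    have := congrArg (· * A) hd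
    simp only [add_mul, Matrix.mul_assoc, hBA, Matrix.mul_one, Matrix.zero_mul] at this
    rw [Matrix.mul_assoc]
    exact eq_neg_of_add_eq_zero_left this
  have h6 := congrFun (congrFun h5 n) p
  simp only [Matrix.neg_apply, Matrix.mul_assoc, Matrix.mul_apply, A, B', A', Matrix.of_apply]
    at h6
  rw [h6, ← Finset.sum_neg_distrib]
  refine Finset.sum_congr rfl fun i _ => ?_
  rw [hJanti x n i, Finset.mul_sum, ← Finset.sum_neg_distrib]
  refine Finset.sum_congr rfl fun j _ => ?_
  ring

/-- For mutually inverse smooth antisymmetric matrix fields `J` and `Ω` on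
`ℝ^m`, one has `Ω_{kij} J^{km'} J^{in} J^{jp} = J^{m'np}` (summation over `k, i, j`). -/
theorem symplecticizer_contract_eq_jacobiizer {m : ℕ}
    (J Ω : (Fin m → ℝ) → Fin m → Fin m → ℝ)
    (hJsmooth : ∀ i j, ContDiff ℝ (⊤ : ℕ∞) fun x => J x i j)
    (hΩsmooth : ∀ i j, ContDiff ℝ (⊤ : ℕ∞) fun x => Ω x i j)
    (hJanti : ∀ (x : Fin m → ℝ) (i j : Fin m), J x i j = - J x j i)
    (hΩanti : ∀ (x : Fin m → ℝ) (i j : Fin m), Ω x i j = - Ω x j i)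
    (hinv : ∀ (x : Fin m → ℝ) (i k : Fin m),
      ∑ j, J x i j * Ω x j k = if i = k then (1 : ℝ) else 0) :
    ∀ (x : Fin m → ℝ) (m' n p : Fin m),
      ∑ k, ∑ i, ∑ j, symplecticizer Ω x k i j * J x k m' * J x i n * J x j p =
        jacobiizer J x m' n p := by
  intro x a n p
  have key := pd_contract J Ω hJsmooth hΩsmooth hJanti hinv x
  simp only [symplecticizer, jacobiizer, add_mul, Finset.sum_add_distrib]
  congr 1
  · congr 1
    · refine Finset.sum_congr rfl fun k _ => ?_
      rw [← key k n p, Finset.mul_sum]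
      refine Finset.sum_congr rfl fun i _ => ?_
      rw [Finset.mul_sum]
      refine Finset.sum_congr rfl fun j _ => ?_
      ring
    · rw [Finset.sum_comm]
      refine Finset.sum_congr rfl fun i _ => ?_
      rw [← key i p a, Finset.mul_sum, Finset.sum_comm]
      refine Finset.sum_congr rfl fun j _ => ?_
      rw [Finset.mul_sum]
      refine Finset.sum_congr rfl fun k _ => ?_
      ring
  · rw [Finset.sum_congr rfl fun k _ => Finset.sum_comm, Finset.sum_comm]
    refine Finset.sum_congr rfl fun j _ => ?_
    rw [← key j a n, Finset.mul_sum]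
    refine Finset.sum_congr rfl fun k _ => ?_
    rw [Finset.mul_sum]
    refine Finset.sum_congr rfl fun i _ => ?_
    ring
end

section
/- Let m ∈ ℕ and let J, Ω : ℝ^m → (Fin m → Fin m → ℝ) be smooth matrix-valued functions, each antisymmetric, which are pointwise mutually inverse: Σ_j J x i j · Ω x j k = δ_{ik} for all x, i, k. Then for all x and all indices k, i, j: Σ_{m',n,p} (Σ_l (J x l m' · ∂_l J x n p + J x l n · ∂_l J x p m' + J x l p · ∂_l J x m' n)) · Ω x m' k · Ω x n i · Ω x p j = ∂_k Ω x i j + ∂_i Ω x j k + ∂_j Ω x k i, where ∂_l denotes the partial derivative in the l-th coordinate direction. -/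
theorem aux_contract {m : ℕ} (A W : Fin m → Fin m → ℝ) (D E : Fin m → Fin m → Fin m → ℝ)
    (h : ∀ i k, ∑ j, A i j * W j k = if i = k then (1 : ℝ) else 0)
    (hD : ∀ l i j, ∑ n, ∑ p, D l n p * W n i * W p j = E l i j) (k i j : Fin m) :
    ∑ a, ∑ b, ∑ c, (∑ l, A l a * D l b c) * W a k * W b i * W c j = E k i j := by
  have h1 : ∀ a, ∑ b, ∑ c, (∑ l, A l a * D l b c) * W a k * W b i * W c j
      = ∑ l, (A l a * W a k) * E l i j := by
    intro a
    have h2 : ∀ b, ∑ c, (∑ l, A l a * D l b c) * W a k * W b i * W c j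
        = ∑ l, ∑ c, A l a * W a k * (D l b c * W b i * W c j) := by
      intro b
      rw [Finset.sum_comm]
      refine Finset.sum_congr rfl fun c _ => ?_
      simp_rw [Finset.sum_mul]
      exact Finset.sum_congr rfl fun l _ => by ring
    simp_rw [h2, ← hD, Finset.mul_sum]
    exact Finset.sum_comm
  simp_rw [h1]
  rw [Finset.sum_comm]
  simp_rw [← Finset.sum_mul, h]
  simp

theorem aux_deriv {m : ℕ} (A W : Fin m → Fin m → ℝ) (D E : Fin m → Fin m → ℝ)
    (hA : ∀ i j, A i j = - A j i)
    (h : ∀ i k, ∑ j, A i j * W j k = if i = k then (1 : ℝ) else 0)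
    (hD : ∀ n j, ∑ p, (A n p * E p j + D n p * W p j) = 0) (i j : Fin m) :
    ∑ n, ∑ p, D n p * W n i * W p j = E i j := by
  have h1 : ∀ n, ∑ p, D n p * W n i * W p j = ∑ p, (A p n * W n i) * E p j := by
    intro n
    have h2 := hD n j
    rw [Finset.sum_add_distrib] at h2
    calc ∑ p, D n p * W n i * W p j = W n i * ∑ p, D n p * W p j := by
          rw [Finset.mul_sum]; exact Finset.sum_congr rfl fun p _ => by ring
      _ = - (W n i * ∑ p, A n p * E p j) := by
          rw [show ∑ p, D n p * W p j = - ∑ p, A n p * E p j by linarith]; ring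
      _ = _ := by
          rw [Finset.mul_sum, ← Finset.sum_neg_distrib]
          exact Finset.sum_congr rfl fun p _ => by rw [hA p n]; ring
  simp_rw [h1]
  rw [Finset.sum_comm]
  simp_rw [← Finset.sum_mul, h]
  simp

/-- For mutually inverse smooth antisymmetric matrix fields `J` and `Ω` on
`ℝ^m`, one has `J^{m'np} Ω_{m'k} Ω_{ni} Ω_{pj} = Ω_{kij}` (summation over `m', n, p`). -/
theorem jacobiizer_contract_eq_symplecticizer {m : ℕ}
    (J Ω : (Fin m → ℝ) → Fin m → Fin m → ℝ)
    (hJsmooth : ∀ i j, ContDiff ℝ (⊤ : ℕ∞) fun x => J x i j)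
    (hΩsmooth : ∀ i j, ContDiff ℝ (⊤ : ℕ∞) fun x => Ω x i j)
    (hJanti : ∀ (x : Fin m → ℝ) (i j : Fin m), J x i j = - J x j i)
    (hΩanti : ∀ (x : Fin m → ℝ) (i j : Fin m), Ω x i j = - Ω x j i)
    (hinv : ∀ (x : Fin m → ℝ) (i k : Fin m),
      ∑ j, J x i j * Ω x j k = if i = k then (1 : ℝ) else 0) :
    ∀ (x : Fin m → ℝ) (k i j : Fin m),
      ∑ m', ∑ n, ∑ p, jacobiizer J x m' n p * Ω x m' k * Ω x n i * Ω x p j =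
        symplecticizer Ω x k i j := by
  intro x k i j
  have hd : ∀ l n j, ∑ p, (J x n p * pd l (fun y => Ω y p j) x
      + pd l (fun y => J y n p) x * Ω x p j) = 0 := by
    intro l n j
    have hJd : ∀ p, HasFDerivAt (fun y => J y n p) (fderiv ℝ (fun y => J y n p) x) x :=
      fun p => ((hJsmooth n p).differentiable (by simp) x).hasFDerivAt
    have hWd : ∀ p, HasFDerivAt (fun y => Ω y p j) (fderiv ℝ (fun y => Ω y p j) x) x :=
      fun p => ((hΩsmooth p j).differentiable (by simp) x).hasFDerivAt
    have h1 := HasFDerivAt.fun_sum (u := Finset.univ) fun p _ => (hJd p).fun_mul (hWd p)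
    simp_rw [hinv] at h1
    have h2 := h1.unique (hasFDerivAt_const _ x)
    have h3 := congrArg (fun L => L (Pi.single l 1)) h2
    simp only [ContinuousLinearMap.sum_apply, ContinuousLinearMap.add_apply,
      ContinuousLinearMap.smul_apply, smul_eq_mul, ContinuousLinearMap.zero_apply] at h3
    rw [← h3]
    exact Finset.sum_congr rfl fun p _ => by unfold pd; ring
  have key := aux_contract (J x) (Ω x) (fun l n p => pd l (fun y => J y n p) x)
    (fun l n p => pd l (fun y => Ω y n p) x) (hinv x)
    (fun l => aux_deriv (J x) (Ω x) _ _ (hJanti x) (hinv x) (hd l))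
  unfold symplecticizer jacobiizer
  simp_rw [Finset.sum_add_distrib, add_mul, Finset.sum_add_distrib]
  refine congrArg₂ (· + ·) (congrArg₂ (· + ·) (key k i j) ?_) ?_
  · rw [← key i j k, Finset.sum_comm]
    refine Finset.sum_congr rfl fun b _ => ?_
    rw [Finset.sum_comm]
    exact Finset.sum_congr rfl fun c _ => Finset.sum_congr rfl fun a _ => by ring
  · rw [← key j k i]
    refine Eq.trans (Finset.sum_congr rfl fun a _ => Finset.sum_comm) ?_
    rw [Finset.sum_comm]
    exact Finset.sum_congr rfl fun c _ => Finset.sum_congr rfl fun a _ =>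
      Finset.sum_congr rfl fun b _ => by ring
end

section
/- Let m ∈ ℕ and let J, Ω : ℝ^m → (Fin m → Fin m → ℝ) be smooth matrix-valued functions, each antisymmetric, which are pointwise mutually inverse: Σ_j J x i j · Ω x j k = δ_{ik} for all x, i, k. Then the symplecticizer of Ω vanishes identically (for all x, k, i, j: ∂_k Ω x i j + ∂_i Ω x j k + ∂_j Ω x k i = 0) if and only if the Jacobiizer of J vanishes identically (for all x, k, i, j: Σ_l (J x l k · ∂_l J x i j + J x l i · ∂_l J x j k + J x l j · ∂_l J x k i) = 0). -/
/-- Contraction with an invertible matrix is injective. -/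
theorem contract_inj {m : ℕ} (A B : Matrix (Fin m) (Fin m) ℝ) (h : B * A = 1)
    (f : Fin m → ℝ) (hf : ∀ k, ∑ l, A k l * f l = 0) (l : Fin m) : f l = 0 := by
  have h1 : A.mulVec f = 0 := by
    funext k
    exact hf k
  have h2 : f = 0 := by
    rw [← Matrix.one_mulVec f, ← h, ← Matrix.mulVec_mulVec, h1, Matrix.mulVec_zero]
  rw [h2]
  rfl

/-- The Jacobiizer is minus the symplecticizer with its indices raised. -/
theorem jac_eq_contract {m : ℕ} (A : Fin m → Fin m → ℝ) (dA dB : Fin m → Fin m → Fin m → ℝ)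
    (hA : ∀ i j, A i j = - A j i)
    (hd : ∀ l i j, dA l i j = ∑ a, ∑ b, A i a * (A j b * dB l a b)) (k i j : Fin m) :
    ∑ l, (A l k * dA l i j + A l i * dA l j k + A l j * dA l k i) =
      - ∑ l, A k l * ∑ a, A i a * ∑ b, A j b * (dB l a b + dB a b l + dB b l a) := by
  have key : ∀ k i j, ∑ l, A l k * dA l i j =
      - ∑ l, ∑ a, ∑ b, A k l * (A i a * (A j b * dB l a b)) := by
    intro k i j
    rw [← Finset.sum_neg_distrib]
    refine Finset.sum_congr rfl fun l _ => ?_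
    rw [hd, hA l k, neg_mul, Finset.mul_sum]
    simp only [Finset.mul_sum]
  rw [Finset.sum_add_distrib, Finset.sum_add_distrib, key, key, key]
  have e2 : ∑ l, ∑ a, ∑ b, A i l * (A j a * (A k b * dB l a b)) =
      ∑ l, ∑ a, ∑ b, A k l * (A i a * (A j b * dB a b l)) := by
    calc _ = ∑ l, ∑ b, ∑ a, A i l * (A j a * (A k b * dB l a b)) :=
          Finset.sum_congr rfl fun l _ => Finset.sum_comm
      _ = ∑ b, ∑ l, ∑ a, A i l * (A j a * (A k b * dB l a b)) := Finset.sum_comm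
      _ = _ := by
        refine Finset.sum_congr rfl fun _ _ => Finset.sum_congr rfl fun _ _ =>
          Finset.sum_congr rfl fun _ _ => ?_
        ring
  have e3 : ∑ l, ∑ a, ∑ b, A j l * (A k a * (A i b * dB l a b)) =
      ∑ l, ∑ a, ∑ b, A k l * (A i a * (A j b * dB b l a)) := by
    calc _ = ∑ a, ∑ l, ∑ b, A j l * (A k a * (A i b * dB l a b)) := Finset.sum_comm
      _ = ∑ a, ∑ b, ∑ l, A j l * (A k a * (A i b * dB l a b)) :=
          Finset.sum_congr rfl fun l _ => Finset.sum_comm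
      _ = _ := by
        refine Finset.sum_congr rfl fun _ _ => Finset.sum_congr rfl fun _ _ =>
          Finset.sum_congr rfl fun _ _ => ?_
        ring
  rw [e2, e3]
  simp only [Finset.mul_sum, mul_add, Finset.sum_add_distrib]
  ring

/-- For mutually inverse smooth antisymmetric matrix fields `J` and `Ω` on
`ℝ^m`, the symplecticizer of `Ω` vanishes identically if and only if the Jacobiizer of
`J` vanishes identically: `Ω = J⁻¹` is symplectic iff `J = Ω⁻¹` is Poisson. -/
theorem symplectic_iff_poisson {m : ℕ}
    (J Ω : (Fin m → ℝ) → Fin m → Fin m → ℝ)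
    (hJsmooth : ∀ i j, ContDiff ℝ (⊤ : ℕ∞) fun x => J x i j)
    (hΩsmooth : ∀ i j, ContDiff ℝ (⊤ : ℕ∞) fun x => Ω x i j)
    (hJanti : ∀ (x : Fin m → ℝ) (i j : Fin m), J x i j = - J x j i)
    (hΩanti : ∀ (x : Fin m → ℝ) (i j : Fin m), Ω x i j = - Ω x j i)
    (hinv : ∀ (x : Fin m → ℝ) (i k : Fin m),
      ∑ j, J x i j * Ω x j k = if i = k then (1 : ℝ) else 0) :
    (∀ (x : Fin m → ℝ) (k i j : Fin m), symplecticizer Ω x k i j = 0) ↔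
      (∀ (x : Fin m → ℝ) (k i j : Fin m), jacobiizer J x k i j = 0) := by
  have hAB : ∀ x, (Matrix.of (J x)) * (Matrix.of (Ω x)) = 1 := by
    intro x
    ext i k
    rw [Matrix.mul_apply, Matrix.one_apply]
    exact hinv x i k
  have hBA : ∀ x, (Matrix.of (Ω x)) * (Matrix.of (J x)) = 1 := fun x =>
    mul_eq_one_comm.mp (hAB x)
  have hJd : ∀ x i j, DifferentiableAt ℝ (fun y => J y i j) x := fun x i j =>
    ((hJsmooth i j).differentiable (by simp)) x
  have hΩd : ∀ x i j, DifferentiableAt ℝ (fun y => Ω y i j) x := fun x i j =>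
    ((hΩsmooth i j).differentiable (by simp)) x
  -- differentiating `J Ω = 1`
  have hprod : ∀ x l i k, ∑ j, (J x i j * pd l (fun y => Ω y j k) x +
      Ω x j k * pd l (fun y => J y i j) x) = 0 := by
    intro x l i k
    have h1 : HasFDerivAt (fun y => ∑ j, J y i j * Ω y j k)
        (∑ j, (J x i j • fderiv ℝ (fun y => Ω y j k) x +
          Ω x j k • fderiv ℝ (fun y => J y i j) x)) x :=
      HasFDerivAt.fun_sum fun j _ => (hJd x i j).hasFDerivAt.mul (hΩd x j k).hasFDerivAt
    have h2 : HasFDerivAt (fun y => ∑ j, J y i j * Ω y j k)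
        (0 : (Fin m → ℝ) →L[ℝ] ℝ) x := by
      simp only [hinv]
      exact hasFDerivAt_const _ _
    have h3 := congrArg (fun T : (Fin m → ℝ) →L[ℝ] ℝ => T (Pi.single l 1)) (h1.unique h2)
    simpa [pd, ContinuousLinearMap.sum_apply] using h3
  have hd : ∀ x l i j, pd l (fun y => J y i j) x =
      ∑ a, ∑ b, J x i a * (J x j b * pd l (fun y => Ω y a b) x) := by
    intro x l i j
    have hM : Matrix.of (fun i j => pd l (fun y => J y i j) x) * Matrix.of (Ω x) =
        - (Matrix.of (J x) * Matrix.of (fun i j => pd l (fun y => Ω y i j) x)) := by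
      ext i k
      have := hprod x l i k
      rw [Finset.sum_add_distrib] at this
      simp only [Matrix.mul_apply, Matrix.neg_apply, Matrix.of_apply]
      simp only [mul_comm (pd l _ x) (Ω x _ k)]
      linarith
    have hM2 := congrArg (fun M => (M * Matrix.of (J x)) i j) hM
    simp only [Matrix.mul_assoc, hBA, Matrix.mul_one, Matrix.neg_mul] at hM2
    simp only [Matrix.mul_apply, Matrix.neg_apply, Matrix.of_apply] at hM2
    rw [hM2, ← Finset.sum_neg_distrib]
    refine Finset.sum_congr rfl fun a _ => ?_
    rw [← mul_neg, ← Finset.sum_neg_distrib, Finset.mul_sum]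
    refine Finset.sum_congr rfl fun b _ => ?_
    rw [hJanti x b j]
    ring
  have hmain : ∀ x k i j, jacobiizer J x k i j =
      - ∑ l, J x k l * ∑ a, J x i a * ∑ b, J x j b * symplecticizer Ω x l a b :=
    fun x k i j => jac_eq_contract (J x) (fun l i j => pd l (fun y => J y i j) x)
      (fun l i j => pd l (fun y => Ω y i j) x) (hJanti x) (hd x) k i j
  constructor
  · intro h x k i j
    rw [hmain]
    simp [h]
  · intro h x l a b
    have h0 : ∀ k i j, ∑ l, J x k l * ∑ a, J x i a * ∑ b, J x j b *
        symplecticizer Ω x l a b = 0 := by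
      intro k i j
      have := hmain x k i j
      rw [h] at this
      linarith
    have inj := contract_inj (Matrix.of (J x)) (Matrix.of (Ω x)) (hBA x)
    exact inj (fun b => symplecticizer Ω x l a b) (fun j =>
      inj (fun a => ∑ b, J x j b * symplecticizer Ω x l a b) (fun i =>
        inj (fun l => ∑ a, J x i a * ∑ b, J x j b * symplecticizer Ω x l a b)
          (fun k => h0 k i j) l) a) b
end

section
/- Let n, g ∈ ℕ and let B : ℝ^n → (Fin g → Fin n → ℝ) be smooth with components B^α_μ(q). Define R^α_{μν}(q) := ∂B^α_μ/∂q^ν (q) − ∂B^α_ν/∂q^μ (q), p_α(q,p) := Σ_μ B^α_μ(q)·p_μ, and K^{μν}(q,p) := Σ_α R^α_{μν}(q)·p_α(q,p). Let J : ℝ^n × ℝ^n → (Fin (2n) → Fin (2n) → ℝ) be the block antisymmetric matrix field with q–q block 0, q–p block the identity, p–q block minus the identity, and p–p block K. If the Jacobiizer of J vanishes identically on ℝ^{2n}, then the bracket ⟦f,h⟧(q,p) = Σ_{μ,ν} K^{μν}(q,p)·(∂f/∂p_μ)(q,p)·(∂h/∂p_ν)(q,p) satisfies the Jacobi identity for all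 smooth f, h, k : ℝ^n × ℝ^n → ℝ; consequently J is a sum of the canonical Poisson tensor and a Poisson tensor. -/
/-- The partial derivative of `f : ℝ^n × ℝ^n → ℝ` in the `μ`-th momentum direction. -/
noncomputable def pdp {n : ℕ} (μ : Fin n) (f : (Fin n → ℝ) × (Fin n → ℝ) → ℝ)
    (z : (Fin n → ℝ) × (Fin n → ℝ)) : ℝ :=
  fderiv ℝ f z (0, Pi.single μ 1)

/-- The curvature of the Ehresmann connection with coefficients `B^α_μ(q)`:
`R^α_{μν}(q) = ∂B^α_μ/∂q^ν (q) − ∂B^α_ν/∂q^μ (q)`. -/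
noncomputable def curv {n g : ℕ} (B : (Fin n → ℝ) → Fin g → Fin n → ℝ)
    (α : Fin g) (μ ν : Fin n) : (Fin n → ℝ) → ℝ :=
  fun q => pd ν (fun q' => B q' α μ) q - pd μ (fun q' => B q' α ν) q

/-- The constrained momenta `p_α(q,p) = Σ_μ B^α_μ(q) · p_μ`. -/
noncomputable def pconstr {n g : ℕ} (B : (Fin n → ℝ) → Fin g → Fin n → ℝ)
    (α : Fin g) (z : (Fin n → ℝ) × (Fin n → ℝ)) : ℝ :=
  ∑ μ, B z.1 α μ * z.2 μ

/-- The noncanonical part of the almost Poisson tensor: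
`K^{μν}(q,p) = Σ_α R^α_{μν}(q) · p_α(q,p)`. -/
noncomputable def Kten {n g : ℕ} (B : (Fin n → ℝ) → Fin g → Fin n → ℝ)
    (μ ν : Fin n) (z : (Fin n → ℝ) × (Fin n → ℝ)) : ℝ :=
  ∑ α, curv B α μ ν z.1 * pconstr B α z

/-- The bracket `⟦f,h⟧(q,p) = Σ_{μ,ν} K^{μν}(q,p) · ∂f/∂p_μ · ∂h/∂p_ν`. -/
noncomputable def Kbracket {n g : ℕ} (B : (Fin n → ℝ) → Fin g → Fin n → ℝ)
    (f h : (Fin n → ℝ) × (Fin n → ℝ) → ℝ) : (Fin n → ℝ) × (Fin n → ℝ) → ℝ :=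
  fun z => ∑ μ, ∑ ν, Kten B μ ν z * pdp μ f z * pdp ν h z

/-- A point of `ℝ^{2n} = ℝ^{n+n}` viewed as a pair `(q, p)`. -/
def splitQP {n : ℕ} (x : Fin (n + n) → ℝ) : (Fin n → ℝ) × (Fin n → ℝ) :=
  (fun i => x (Fin.castAdd n i), fun i => x (Fin.natAdd n i))

/-- The block antisymmetric matrix on `ℝ^{2n}` with q–q block `0`, q–p block the
identity, p–q block minus the identity, and p–p block `K`. -/
def blockJ {n : ℕ} (K : Fin n → Fin n → ℝ) : Fin (n + n) → Fin (n + n) → ℝ := fun i j =>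
  Fin.addCases
    (fun iq => Fin.addCases (fun _jq => (0 : ℝ)) (fun jp => if iq = jp then 1 else 0) j)
    (fun ip => Fin.addCases (fun jq => if ip = jq then -1 else 0) (fun jp => K ip jp) j) i

/-- The full almost Poisson tensor of a Chaplygin system, as a matrix field on `ℝ^{2n}`. -/
noncomputable def Jfull {n g : ℕ} (B : (Fin n → ℝ) → Fin g → Fin n → ℝ) :
    (Fin (n + n) → ℝ) → Fin (n + n) → Fin (n + n) → ℝ :=
  fun x => blockJ (fun μ ν => Kten B μ ν (splitQP x))

/-- The canonical Poisson tensor on `ℝ^{2n}` (constant: q–q block 0, q–p block the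
identity, p–q block minus the identity, p–p block 0). -/
def canonicalJ (n : ℕ) : Fin (n + n) → Fin (n + n) → ℝ :=
  blockJ (fun _ _ => (0 : ℝ))

/-- The matrix field on `ℝ^{2n}` whose only nonzero block is the p–p block `K`. -/
noncomputable def KonlyJ {n g : ℕ} (B : (Fin n → ℝ) → Fin g → Fin n → ℝ) :
    (Fin (n + n) → ℝ) → Fin (n + n) → Fin (n + n) → ℝ := fun x i j =>
  Fin.addCases (fun _iq => (0 : ℝ))
    (fun ip => Fin.addCases (fun _jq => (0 : ℝ))
      (fun jp => Kten B ip jp (splitQP x)) j) i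

/-- `Kten` along the momentum direction is affine. -/
lemma Kten_line {n g : ℕ} (B : (Fin n → ℝ) → Fin g → Fin n → ℝ) (μ ν κ : Fin n)
    (x : Fin (n + n) → ℝ) (t : ℝ) :
    Kten B μ ν (splitQP (x + t • Pi.single (Fin.natAdd n κ) (1 : ℝ))) =
      Kten B μ ν (splitQP x) + t * ∑ α, curv B α μ ν (splitQP x).1 * B (splitQP x).1 α κ := by
  have h1 : (splitQP (x + t • Pi.single (Fin.natAdd n κ) (1 : ℝ))).1 = (splitQP x).1 := by
    funext i
    have : Fin.castAdd n i ≠ Fin.natAdd n κ := by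
      intro h
      have := congrArg Fin.val h
      simp at this
      omega
    simp only [splitQP, Pi.add_apply, Pi.smul_apply, Pi.single_apply, if_neg this, smul_zero,
      add_zero]
  have h2 : ∀ i, (splitQP (x + t • Pi.single (Fin.natAdd n κ) (1 : ℝ))).2 i =
      (splitQP x).2 i + if i = κ then t else 0 := by
    intro i
    simp [splitQP, Pi.single_apply]
  simp only [Kten, pconstr, h1, h2, mul_add, Finset.sum_add_distrib, mul_ite, mul_zero,
    Finset.sum_ite_eq', Finset.mem_univ, if_true, Finset.mul_sum]
  congr 1
  refine Finset.sum_congr rfl fun α _ => ?_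
  ring

lemma Kten_diff {n g : ℕ} (B : (Fin n → ℝ) → Fin g → Fin n → ℝ)
    (hB : ∀ (α : Fin g) (μ : Fin n), ContDiff ℝ (⊤ : ℕ∞) fun q => B q α μ) (μ ν : Fin n) :
    Differentiable ℝ fun x : Fin (n + n) → ℝ => Kten B μ ν (splitQP x) := by
  have hs : Differentiable ℝ fun x : Fin (n + n) → ℝ => (splitQP x).1 := by
    unfold splitQP
    fun_prop
  have hp : ∀ i, Differentiable ℝ fun x : Fin (n + n) → ℝ => (splitQP x).2 i := by
    intro i
    unfold splitQP
    fun_prop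
  have hb : ∀ α i, Differentiable ℝ fun x : Fin (n + n) → ℝ => B (splitQP x).1 α i :=
    fun α i => ((hB α i).differentiable (by simp)).comp hs
  have hpd : ∀ α i j, Differentiable ℝ fun q => pd j (fun q' => B q' α i) q := by
    intro α i j
    have h := ((hB α i).fderiv_right (m := 1) (by
      have h2 : ((2 : ℕ∞) : WithTop ℕ∞) ≤ ((⊤ : ℕ∞) : WithTop ℕ∞) := WithTop.coe_le_coe.2 le_top
      exact le_trans (le_of_eq (by norm_num [one_add_one_eq_two])) h2)).differentiable (by simp)
    unfold pd
    exact h.clm_apply (differentiable_const _)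
  have hc : ∀ α, Differentiable ℝ fun x : Fin (n + n) → ℝ => curv B α μ ν (splitQP x).1 := by
    intro α
    have : Differentiable ℝ (curv B α μ ν) := (hpd α μ ν).sub (hpd α ν μ)
    exact this.comp hs
  unfold Kten pconstr
  refine Differentiable.fun_sum fun α _ => (hc α).mul ?_
  exact Differentiable.fun_sum fun i _ => (hb α i).mul (hp i)

lemma pd_Kten {n g : ℕ} (B : (Fin n → ℝ) → Fin g → Fin n → ℝ)
    (hB : ∀ (α : Fin g) (μ : Fin n), ContDiff ℝ (⊤ : ℕ∞) fun q => B q α μ) (μ ν κ : Fin n)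
    (x : Fin (n + n) → ℝ) :
    pd (Fin.natAdd n κ) (fun x => Kten B μ ν (splitQP x)) x =
      ∑ α, curv B α μ ν (splitQP x).1 * B (splitQP x).1 α κ := by
  unfold pd
  rw [← ((Kten_diff B hB μ ν) x).lineDeriv_eq_fderiv, lineDeriv]
  simp only [Kten_line]
  simp

/-- Vanishing of the `(q, p, p)` components forces `∂K/∂p = 0`, hence `K = 0` by linearity. -/
lemma Kten_eq_zero {n g : ℕ} (B : (Fin n → ℝ) → Fin g → Fin n → ℝ)
    (hB : ∀ (α : Fin g) (μ : Fin n), ContDiff ℝ (⊤ : ℕ∞) fun q => B q α μ)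
    (hJfull : ∀ (x : Fin (n + n) → ℝ) (k i j : Fin (n + n)),
      jacobiizer (Jfull B) x k i j = 0) (μ ν : Fin n) (z : (Fin n → ℝ) × (Fin n → ℝ)) :
    Kten B μ ν z = 0 := by
  have key : ∀ κ, ∑ α, curv B α μ ν z.1 * B z.1 α κ = 0 := by
    intro κ
    have hx : splitQP (Fin.append z.1 z.2) = z := by
      simp only [splitQP, Fin.append_left, Fin.append_right]
    have h := hJfull (Fin.append z.1 z.2) (Fin.castAdd n κ) (Fin.natAdd n μ) (Fin.natAdd n ν)
    have hpd0 : ∀ (l : Fin (n + n)) (c : ℝ) x, pd l (fun _ => c) x = 0 := by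
      intro l c x
      simp [pd]
    simp only [jacobiizer, Jfull, blockJ, Fin.addCases_left, Fin.addCases_right, hpd0,
      mul_zero, add_zero, Fin.sum_univ_add, zero_mul, Finset.sum_const_zero, zero_add,
      pd_Kten B hB, hx, ite_mul, Finset.sum_ite_eq', Finset.mem_univ, if_true] at h
    linarith
  have : Kten B μ ν z = ∑ κ, (∑ α, curv B α μ ν z.1 * B z.1 α κ) * z.2 κ := by
    simp only [Kten, pconstr, Finset.mul_sum, Finset.sum_mul]
    rw [Finset.sum_comm]
    simp only [mul_assoc]
  rw [this]
  simp [key]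

/-- If the Jacobiizer of the full Chaplygin almost Poisson tensor `J`
vanishes identically on `ℝ^{2n}`, then the bracket `⟦·,·⟧` built from `K` satisfies the
Jacobi identity for all smooth functions; consequently `J` is the sum of the canonical
Poisson tensor and a Poisson tensor. -/
theorem chaplygin_Jfull_poisson_decomposition {n g : ℕ}
    (B : (Fin n → ℝ) → Fin g → Fin n → ℝ)
    (hB : ∀ (α : Fin g) (μ : Fin n), ContDiff ℝ (⊤ : ℕ∞) fun q => B q α μ)
    (hJfull : ∀ (x : Fin (n + n) → ℝ) (k i j : Fin (n + n)),
      jacobiizer (Jfull B) x k i j = 0) :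
    (∀ f h k : (Fin n → ℝ) × (Fin n → ℝ) → ℝ,
        ContDiff ℝ (⊤ : ℕ∞) f → ContDiff ℝ (⊤ : ℕ∞) h → ContDiff ℝ (⊤ : ℕ∞) k →
        ∀ z, Kbracket B (Kbracket B f h) k z + Kbracket B (Kbracket B h k) f z +
          Kbracket B (Kbracket B k f) h z = 0) ∧
      (∀ (x : Fin (n + n) → ℝ) (i j : Fin (n + n)),
        Jfull B x i j = canonicalJ n i j + KonlyJ B x i j) ∧
      (∀ (x : Fin (n + n) → ℝ) (k i j : Fin (n + n)),
        jacobiizer (KonlyJ B) x k i j = 0) := by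
  have hK := Kten_eq_zero B hB hJfull
  have hO : ∀ x i j, KonlyJ B x i j = 0 := by
    intro x i j
    refine Fin.addCases (fun a => ?_) (fun a => ?_) i <;>
    refine Fin.addCases (fun b => ?_) (fun b => ?_) j <;>
    simp only [KonlyJ, hK, Fin.addCases_left, Fin.addCases_right]
  refine ⟨?_, ?_, ?_⟩
  · intro f h k _ _ _ z
    simp [Kbracket, hK]
  · intro x i j
    rw [hO]
    simp [Jfull, canonicalJ, hK]
  · intro x k i j
    simp [jacobiizer, hO]
end

section
/- Let n ∈ ℕ and let S : Fin n → Fin n → Fin n → ℝ, written S^σ_{μν}, be constants antisymmetric in the lower indices: S^σ_{μν} = −S^σ_{νμ}. Let J : ℝ^n × ℝ^n → (Fin (2n) → Fin (2n) → ℝ) be the block antisymmetric matrix field with q–q block 0, q–p block the identity, p–q block minus the identity, and p–p block K^{μν}(p) = 2·Σ_σ S^σ_{μν}·p_σ. Then the Jacobiizer of J vanishes identically on ℝ^{2n} if and only if S = 0. In particular, even when S satisfies the Lie-algebra Jacobi condition Σ_σ (S^σ_{νρ}·S^τ_{σλ} + S^σ_{ρλ}·S^τ_{σν} + S^σ_{λν}·S^τ_{σρ})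 = 0 (so that the p-block bracket is Poisson), the full almost Poisson tensor J is not a Poisson tensor unless S = 0. -/
/-- The full almost Poisson tensor of autoparallel motion on an affine space with
constant torsion `S`: block matrix field on `ℝ^{2n}` whose p–p block is
`K^{μν}(p) = 2 Σ_σ S^σ_{μν} p_σ`, the momenta `p` being the last `n` coordinates. -/
def torsionJ {n : ℕ} (S : Fin n → Fin n → Fin n → ℝ) :
    (Fin (n + n) → ℝ) → Fin (n + n) → Fin (n + n) → ℝ := fun x =>
  blockJ (fun μ ν => 2 * ∑ σ, S σ μ ν * x (Fin.natAdd n σ))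

theorem pd_const_aux {m : ℕ} (l : Fin m) (c : ℝ) (x : Fin m → ℝ) :
    pd l (fun _ => c) x = 0 := by
  simp [pd]

theorem pd_lin_aux {n : ℕ} (a : Fin n → ℝ) (l : Fin n) (x : Fin (n + n) → ℝ) :
    pd (Fin.natAdd n l) (fun y => 2 * ∑ σ, a σ * y (Fin.natAdd n σ)) x = 2 * a l := by
  have h : HasFDerivAt (fun y : Fin (n + n) → ℝ => 2 * ∑ σ, a σ * y (Fin.natAdd n σ))
      ((2 : ℝ) • ∑ σ, a σ • (ContinuousLinearMap.proj (R := ℝ) (φ := fun _ : Fin (n + n) => ℝ)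
        (Fin.natAdd n σ))) x := by
    refine HasFDerivAt.const_mul (HasFDerivAt.fun_sum fun σ _ => ?_) 2
    exact HasFDerivAt.const_mul (hasFDerivAt_apply (Fin.natAdd n σ) x) (a σ)
  unfold pd
  rw [h.fderiv]
  simp [Pi.single_apply]

theorem forward_aux {n : ℕ} (S : Fin n → Fin n → Fin n → ℝ)
    (h : ∀ (x : Fin (n + n) → ℝ) (k i j : Fin (n + n)),
      jacobiizer (torsionJ S) x k i j = 0) : S = 0 := by
  funext τ μ ν
  have h1 := h 0 (Fin.castAdd n τ) (Fin.natAdd n μ) (Fin.natAdd n ν)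
  simp only [jacobiizer, torsionJ, blockJ, Fin.sum_univ_add, Fin.addCases_left,
    Fin.addCases_right, pd_const_aux, pd_lin_aux] at h1
  simpa using h1

theorem backward_aux {n : ℕ} (x : Fin (n + n) → ℝ) (k i j : Fin (n + n)) :
    jacobiizer (torsionJ (0 : Fin n → Fin n → Fin n → ℝ)) x k i j = 0 := by
  simp [jacobiizer, torsionJ, pd_const_aux]

/-- The Jacobiizer of the full almost Poisson tensor `J` of autoparallel
motion vanishes identically if and only if the torsion `S` vanishes. In particular,
even when `S` satisfies the Lie-algebra Jacobi condition (so that the p-block bracket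
is Poisson), the full tensor `J` is not a Poisson tensor unless `S = 0`. -/
theorem torsionJ_poisson_iff_torsion_eq_zero {n : ℕ}
    (S : Fin n → Fin n → Fin n → ℝ)
    (hSanti : ∀ σ μ ν : Fin n, S σ μ ν = - S σ ν μ) :
    ((∀ (x : Fin (n + n) → ℝ) (k i j : Fin (n + n)),
        jacobiizer (torsionJ S) x k i j = 0) ↔ S = 0) ∧
      ((∀ τ ν ρ l : Fin n,
          ∑ σ, (S σ ν ρ * S τ σ l + S σ ρ l * S τ σ ν + S σ l ν * S τ σ ρ) = 0) →
        (∀ (x : Fin (n + n) → ℝ) (k i j : Fin (n + n)),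
          jacobiizer (torsionJ S) x k i j = 0) → S = 0) := by
  refine ⟨⟨forward_aux S, ?_⟩, fun _ => forward_aux S⟩
  rintro rfl x k i j
  exact backward_aux x k i j
end
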